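/- arXiv:2306.03382 — 2 statements merged into one kernel-verified Lean document; each statement's English description precedes it below -/
import Mathlib

section
/- Let 0 ≤ m < n be integers, let E ⊆ ℝⁿ be an H^m-rectifiable set, and let u : ℝⁿ → [0,∞) be a bounded Borel measurable function. Then the m-dimensional lower u-Minkowski content of E dominates the weighted Hausdorff integral: liminf_{r→0⁺} H^n(⋃_{x∈E} B(x, u(x)·r)) / (ω(n−m)·r^{n−m}) ≥ ∫_E u(x)^{n−m} dH^m(x). -/
open MeasureTheory Metric Filter Set

noncomputable section

/-- `ω k`: the Lebesgue volume of the unit ball in `ℝᵏ`. -/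
def unitBallVol (k : ℕ) : ℝ :=
  (volume (Metric.ball (0 : EuclideanSpace ℝ (Fin k)) 1)).toReal

/-- The `d`-dimensional Hausdorff measure on `ℝⁿ`, normalized (à la Federer, with the gauge
`ω(d)·2^{-d}·(diam U)^d`) so that it agrees with Lebesgue measure on `d`-dimensional affine
subspaces. -/
def normHausdorff (n d : ℕ) : Measure (EuclideanSpace ℝ (Fin n)) :=
  (ENNReal.ofReal (unitBallVol d / 2 ^ d)) • μH[(d : ℝ)]

/-- `E ⊆ ℝⁿ` is `m`-rectifiable: there are a bounded set `F ⊆ ℝᵐ` and a Lipschitz map `Ψ`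
with `Ψ(F) = E`. -/
def MRectifiable (m n : ℕ) (E : Set (EuclideanSpace ℝ (Fin n))) : Prop :=
  ∃ (F : Set (EuclideanSpace ℝ (Fin m)))
    (Ψ : EuclideanSpace ℝ (Fin m) → EuclideanSpace ℝ (Fin n)) (K : NNReal),
      Bornology.IsBounded F ∧ LipschitzOnWith K Ψ F ∧ Ψ '' F = E

/-- `E ⊆ ℝⁿ` is countably `m`-rectifiable: it is a countable union of `m`-rectifiable sets. -/
def CountablyMRectifiable (m n : ℕ) (E : Set (EuclideanSpace ℝ (Fin n))) : Prop :=
  ∃ F : ℕ → Set (EuclideanSpace ℝ (Fin n)), (∀ i, MRectifiable m n (F i)) ∧ E = ⋃ i, F i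

/-- `E ⊆ ℝⁿ` is `H^m`-rectifiable: there is a countably `m`-rectifiable `F` with
`H^m(E \ F) = 0`. -/
def HmRectifiable (m n : ℕ) (E : Set (EuclideanSpace ℝ (Fin n))) : Prop :=
  ∃ F : Set (EuclideanSpace ℝ (Fin n)),
    CountablyMRectifiable m n F ∧ normHausdorff n m (E \ F) = 0

theorem volume_add_volume_le_of_abs_sub_le {A B : Set ℝ} (hA : A.Nonempty) (hB : B.Nonempty)
    {ρ : ℝ} (h : ∀ a ∈ A, ∀ b ∈ B, |a - b| ≤ ρ) :
    volume A + volume B ≤ ENNReal.ofReal (2 * ρ) := by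
  obtain ⟨a₀, ha₀⟩ := hA
  obtain ⟨b₀, hb₀⟩ := hB
  have hAb : BddBelow A := ⟨b₀ - ρ, fun a ha => by linarith [(abs_le.1 (h a ha b₀ hb₀)).1]⟩
  have hAa : BddAbove A := ⟨b₀ + ρ, fun a ha => by linarith [(abs_le.1 (h a ha b₀ hb₀)).2]⟩
  have hBb : BddBelow B := ⟨a₀ - ρ, fun b hb => by linarith [(abs_le.1 (h a₀ ha₀ b hb)).2]⟩
  have hBa : BddAbove B := ⟨a₀ + ρ, fun b hb => by linarith [(abs_le.1 (h a₀ ha₀ b hb)).1]⟩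
  have h1 : sSup A ≤ sInf B + ρ := by
    refine csSup_le ⟨a₀, ha₀⟩ fun a ha => ?_
    have : a - ρ ≤ sInf B :=
      le_csInf ⟨b₀, hb₀⟩ fun b hb => by linarith [(abs_le.1 (h a ha b hb)).2]
    linarith
  have h2 : sSup B ≤ sInf A + ρ := by
    refine csSup_le ⟨b₀, hb₀⟩ fun b hb => ?_
    have : b - ρ ≤ sInf A :=
      le_csInf ⟨a₀, ha₀⟩ fun a ha => by linarith [(abs_le.1 (h a ha b hb)).1]
    linarith
  have hA' : volume A ≤ ENNReal.ofReal (sSup A - sInf A) := by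
    rw [← Real.volume_Icc]
    exact measure_mono (subset_Icc_csInf_csSup hAb hAa)
  have hB' : volume B ≤ ENNReal.ofReal (sSup B - sInf B) := by
    rw [← Real.volume_Icc]
    exact measure_mono (subset_Icc_csInf_csSup hBb hBa)
  calc volume A + volume B
      ≤ ENNReal.ofReal (sSup A - sInf A) + ENNReal.ofReal (sSup B - sInf B) := add_le_add hA' hB'
    _ = ENNReal.ofReal ((sSup A - sInf A) + (sSup B - sInf B)) :=
        (ENNReal.ofReal_add (sub_nonneg.2 (Real.sInf_le_sSup A hAb hAa))
          (sub_nonneg.2 (Real.sInf_le_sSup B hBb hBa))).symm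
    _ ≤ _ := ENNReal.ofReal_le_ofReal (by linarith)

/-- Lebesgue measure of the line section of `U` through `x` in the direction of coordinate `i`. -/
def sectionVolume {ι : Type*} [DecidableEq ι] (U : Set (ι → ℝ)) (i : ι) (x : ι → ℝ) : ENNReal :=
  volume {t : ℝ | Function.update x i t ∈ U}

/-- Steiner symmetrization of `U` with respect to the hyperplane `x i = 0`. -/
def steinerSymm {ι : Type*} [DecidableEq ι] (U : Set (ι → ℝ)) (i : ι) : Set (ι → ℝ) :=
  {x | ENNReal.ofReal (2 * |x i|) < sectionVolume U i x}

section Steiner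

variable {ι : Type*} [DecidableEq ι]

theorem sectionVolume_update (U : Set (ι → ℝ)) (i : ι) (x : ι → ℝ) (t : ℝ) :
    sectionVolume U i (Function.update x i t) = sectionVolume U i x := by
  simp [sectionVolume]

theorem sum_sq_update_sub [Fintype ι] (x y : ι → ℝ) (i : ι) (s t : ℝ) :
    ∑ j, (Function.update x i s j - Function.update y i t j) ^ 2
      = (s - t) ^ 2 + ∑ j ∈ Finset.univ.erase i, (x j - y j) ^ 2 := by
  rw [← Finset.add_sum_erase _ _ (Finset.mem_univ i)]
  congr 1
  · simp
  · refine Finset.sum_congr rfl fun j hj => ?_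
    simp [Finset.ne_of_mem_erase hj]

theorem sectionVolume_ne_top [Fintype ι] {U : Set (ι → ℝ)} {D : ℝ}
    (hD : ∀ x ∈ U, ∀ y ∈ U, ∑ j, (x j - y j) ^ 2 ≤ D) (i : ι) (x : ι → ℝ) :
    sectionVolume U i x ≠ ⊤ := by
  rcases Set.eq_empty_or_nonempty {t : ℝ | Function.update x i t ∈ U} with h | h
  · simp [sectionVolume, h]
  · have := volume_add_volume_le_of_abs_sub_le h h (ρ := √D) fun a ha b hb => by
      have := hD _ ha _ hb
      rw [sum_sq_update_sub] at this
      refine Real.abs_le_sqrt (le_trans ?_ this)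
      simp
    exact ne_top_of_le_ne_top ENNReal.ofReal_ne_top (le_trans le_self_add this)

theorem lmarginal_indicator_eq_sectionVolume {U : Set (ι → ℝ)}
    (hU : MeasurableSet U) (i : ι) :
    lmarginal (fun _ : ι => (volume : Measure ℝ)) {i} (U.indicator 1) = sectionVolume U i := by
  rw [lmarginal_singleton]
  ext x
  rw [sectionVolume, ← lintegral_indicator_one]
  · rfl
  · exact hU.preimage (measurable_update x)

theorem measurable_sectionVolume {U : Set (ι → ℝ)} (hU : MeasurableSet U) (i : ι) :
    Measurable (sectionVolume U i) := by
  rw [← lmarginal_indicator_eq_sectionVolume hU]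
  exact Measurable.lmarginal _ (measurable_one.indicator hU)

theorem measurableSet_steinerSymm {U : Set (ι → ℝ)} (hU : MeasurableSet U) (i : ι) :
    MeasurableSet (steinerSymm U i) := by
  refine measurableSet_lt ?_ (measurable_sectionVolume hU i)
  fun_prop

theorem sectionVolume_steinerSymm {U : Set (ι → ℝ)} {i : ι} {x : ι → ℝ}
    (hx : sectionVolume U i x ≠ ⊤) :
    sectionVolume (steinerSymm U i) i x = sectionVolume U i x := by
  have : {t : ℝ | Function.update x i t ∈ steinerSymm U i}
      = Ioo (-((sectionVolume U i x).toReal / 2)) ((sectionVolume U i x).toReal / 2) := by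
    ext t
    simp only [steinerSymm, mem_ofPred_eq, sectionVolume_update, Function.update_self]
    rw [ENNReal.ofReal_lt_iff_lt_toReal (by positivity) hx, mem_Ioo, ← abs_lt]
    constructor <;> intro h <;> linarith
  rw [sectionVolume, this, Real.volume_Ioo]
  ring_nf
  exact ENNReal.ofReal_toReal hx

theorem volume_steinerSymm [Fintype ι] {U : Set (ι → ℝ)} (hU : MeasurableSet U) {D : ℝ}
    (hD : ∀ x ∈ U, ∀ y ∈ U, ∑ j, (x j - y j) ^ 2 ≤ D) (i : ι) :
    volume (steinerSymm U i) = volume U := by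
  have hV := measurableSet_steinerSymm hU i
  rw [← lintegral_indicator_one hU, ← lintegral_indicator_one hV]
  refine lintegral_eq_of_lmarginal_eq (μ := fun _ => volume) {i} (measurable_one.indicator hV)
    (measurable_one.indicator hU) ?_
  rw [lmarginal_indicator_eq_sectionVolume hU, lmarginal_indicator_eq_sectionVolume hV]
  ext x
  exact sectionVolume_steinerSymm (sectionVolume_ne_top hD i x)

theorem sum_sq_sub_le_of_mem_steinerSymm [Fintype ι] {U : Set (ι → ℝ)} {D : ℝ}
    (hD : ∀ x ∈ U, ∀ y ∈ U, ∑ j, (x j - y j) ^ 2 ≤ D) (i : ι) {x y : ι → ℝ}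
    (hx : x ∈ steinerSymm U i) (hy : y ∈ steinerSymm U i) :
    ∑ j, (x j - y j) ^ 2 ≤ D := by
  have hne : ∀ {z}, z ∈ steinerSymm U i → {t : ℝ | Function.update z i t ∈ U}.Nonempty := by
    intro z hz
    by_contra h
    rw [Set.not_nonempty_iff_eq_empty] at h
    simp [steinerSymm, sectionVolume, h] at hz
  have hdist : ∀ a ∈ {t : ℝ | Function.update x i t ∈ U},
      ∀ b ∈ {t : ℝ | Function.update y i t ∈ U},
        (a - b) ^ 2 ≤ D - ∑ j ∈ Finset.univ.erase i, (x j - y j) ^ 2 := fun a ha b hb => by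
    have := hD _ ha _ hb
    rw [sum_sq_update_sub] at this
    linarith
  obtain ⟨a, ha⟩ := hne hx
  obtain ⟨b, hb⟩ := hne hy
  have hR := (sq_nonneg _).trans (hdist a ha b hb)
  have h := volume_add_volume_le_of_abs_sub_le (hne hx) (hne hy)
    fun a ha b hb => Real.abs_le_sqrt (hdist a ha b hb)
  have h2 : ENNReal.ofReal (2 * |x i| + 2 * |y i|)
      ≤ ENNReal.ofReal (2 * √(D - ∑ j ∈ Finset.univ.erase i, (x j - y j) ^ 2)) := by
    rw [ENNReal.ofReal_add (by positivity) (by positivity)]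
    exact (add_le_add hx.le hy.le).trans h
  rw [ENNReal.ofReal_le_ofReal_iff (by positivity)] at h2
  have h3 : |x i - y i| ≤ √(D - ∑ j ∈ Finset.univ.erase i, (x j - y j) ^ 2) := by
    have := abs_sub (x i) (y i)
    linarith
  rw [Real.le_sqrt (abs_nonneg _) hR, sq_abs] at h3
  have := sum_sq_update_sub x y i (x i) (y i)
  simp only [Function.update_eq_self] at this
  linarith

theorem update_neg_mem_steinerSymm_self {U : Set (ι → ℝ)} {i : ι} {x : ι → ℝ}
    (hx : x ∈ steinerSymm U i) : Function.update x i (-x i) ∈ steinerSymm U i := by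
  simpa [steinerSymm, sectionVolume_update] using hx

theorem update_neg_mem_steinerSymm {U : Set (ι → ℝ)} {i j : ι} (hij : j ≠ i)
    (hU : ∀ x ∈ U, Function.update x j (-x j) ∈ U) {x : ι → ℝ}
    (hx : x ∈ steinerSymm U i) : Function.update x j (-x j) ∈ steinerSymm U i := by
  simp only [steinerSymm, mem_ofPred_eq, Function.update_of_ne hij.symm] at hx ⊢
  refine hx.trans_le (measure_mono fun t ht => ?_)
  have := hU _ ht
  rwa [Function.update_of_ne hij, Function.update_comm hij.symm] at this

theorem exists_symmetric_of_sum_sq_le [Fintype ι] {U : Set (ι → ℝ)} (hU : MeasurableSet U) {D : ℝ}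
    (hD : ∀ x ∈ U, ∀ y ∈ U, ∑ j, (x j - y j) ^ 2 ≤ D) (s : Finset ι) :
    ∃ V : Set (ι → ℝ), MeasurableSet V ∧ volume V = volume U ∧
      (∀ x ∈ V, ∀ y ∈ V, ∑ j, (x j - y j) ^ 2 ≤ D) ∧
      ∀ i ∈ s, ∀ x ∈ V, Function.update x i (-x i) ∈ V := by
  induction s using Finset.induction_on with
  | empty => exact ⟨U, hU, rfl, hD, by simp⟩
  | insert i s hi ih =>
    obtain ⟨V, hV, hvol, hVD, hsymm⟩ := ih
    refine ⟨steinerSymm V i, measurableSet_steinerSymm hV i,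
      (volume_steinerSymm hV hVD i).trans hvol,
      fun x hx y hy => sum_sq_sub_le_of_mem_steinerSymm hVD i hx hy, fun j hj x hx => ?_⟩
    rcases eq_or_ne j i with rfl | hne
    · exact update_neg_mem_steinerSymm_self hx
    · exact update_neg_mem_steinerSymm hne
        (hsymm j (Finset.mem_of_mem_insert_of_ne hj hne)) hx

theorem neg_mem_of_forall_update_neg_mem [Fintype ι] {V : Set (ι → ℝ)}
    (hV : ∀ i, ∀ x ∈ V, Function.update x i (-x i) ∈ V) {x : ι → ℝ} (hx : x ∈ V) : -x ∈ V := by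
  have key : ∀ s : Finset ι, (fun j => if j ∈ s then -x j else x j) ∈ V := by
    intro s
    induction s using Finset.induction_on with
    | empty => simpa using hx
    | insert i s hi ih =>
      convert hV i _ ih using 1
      ext j
      rcases eq_or_ne j i with rfl | hne
      · simp [hi]
      · simp [hne]
  have := key Finset.univ
  simp only [Finset.mem_univ, if_true] at this
  exact this

end Steiner

theorem unitBallVol_pos (k : ℕ) : 0 < unitBallVol k :=
  ENNReal.toReal_pos (measure_ball_pos _ _ one_pos).ne' measure_ball_lt_top.ne

theorem ofReal_unitBallVol (k : ℕ) :
    ENNReal.ofReal (unitBallVol k) = volume (ball (0 : EuclideanSpace ℝ (Fin k)) 1) :=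
  ENNReal.ofReal_toReal measure_ball_lt_top.ne

theorem volume_closedBall_eq_unitBallVol {k : ℕ} (x : EuclideanSpace ℝ (Fin k)) {r : ℝ}
    (hr : 0 ≤ r) :
    volume (closedBall x r) = ENNReal.ofReal (r ^ k) * ENNReal.ofReal (unitBallVol k) := by
  rw [Measure.addHaar_closedBall _ _ hr, ofReal_unitBallVol, finrank_euclideanSpace_fin]

theorem volume_ball_eq_unitBallVol {k : ℕ} (x : EuclideanSpace ℝ (Fin k)) {r : ℝ} (hr : 0 < r) :
    volume (ball x r) = ENNReal.ofReal (r ^ k) * ENNReal.ofReal (unitBallVol k) := by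
  rw [Measure.addHaar_ball_of_pos _ _ hr, ofReal_unitBallVol, finrank_euclideanSpace_fin]

/-- The isodiametric inequality. -/
theorem volume_le_unitBallVol_mul_ediam_pow {k : ℕ} (U : Set (EuclideanSpace ℝ (Fin k)))
    (hU : ediam U ≠ ⊤) :
    volume U ≤ ENNReal.ofReal (unitBallVol k / 2 ^ k) * ediam U ^ k := by
  have hb : Bornology.IsBounded U := Metric.isBounded_iff_ediam_ne_top.2 hU
  set C := WithLp.ofLp '' closure U with hC
  have hCpre : C = WithLp.toLp 2 ⁻¹' closure U := by
    ext x
    exact ⟨by rintro ⟨y, hy, rfl⟩; exact hy, fun hx => ⟨_, hx, rfl⟩⟩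
  have hCm : MeasurableSet C := by
    rw [hCpre]
    exact (PiLp.volume_preserving_toLp (Fin k)).measurable isClosed_closure.measurableSet
  have hvol : volume C = volume (closure U) := by
    rw [hCpre]
    exact (PiLp.volume_preserving_toLp (Fin k)).measure_preimage
      isClosed_closure.measurableSet.nullMeasurableSet
  have hD : ∀ x ∈ C, ∀ y ∈ C, ∑ j, (x j - y j) ^ 2 ≤ diam U ^ 2 := by
    rintro _ ⟨x, hx, rfl⟩ _ ⟨y, hy, rfl⟩
    have := dist_le_diam_of_mem hb.closure hx hy
    rw [diam_closure, EuclideanSpace.dist_eq] at this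
    have := Real.sqrt_le_iff.1 this
    simpa [Real.dist_eq, sq_abs] using this.2
  obtain ⟨V, hV, hVvol, hVD, hsymm⟩ := exists_symmetric_of_sum_sq_le hCm hD Finset.univ
  have hsub : WithLp.ofLp ⁻¹' V ⊆ closedBall (0 : EuclideanSpace ℝ (Fin k)) (diam U / 2) := by
    intro x hx
    have := hVD _ hx _ (neg_mem_of_forall_update_neg_mem (fun i => hsymm i (Finset.mem_univ i)) hx)
    rw [mem_closedBall_zero_iff, EuclideanSpace.norm_eq]
    refine Real.sqrt_le_iff.2 ⟨by positivity, ?_⟩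
    have h4 : ∑ j, (x.ofLp j - (-x.ofLp) j) ^ 2 = 4 * ∑ j, ‖x.ofLp j‖ ^ 2 := by
      rw [Finset.mul_sum]
      refine Finset.sum_congr rfl fun j _ => ?_
      simp only [Pi.neg_apply, Real.norm_eq_abs, sq_abs]
      ring
    rw [h4] at this
    linarith
  calc volume U ≤ volume (closure U) := measure_mono subset_closure
    _ = volume (WithLp.ofLp ⁻¹' V : Set (EuclideanSpace ℝ (Fin k))) := by
        rw [(PiLp.volume_preserving_ofLp (Fin k)).measure_preimage hV.nullMeasurableSet, hVvol,
          hvol]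
    _ ≤ volume (closedBall (0 : EuclideanSpace ℝ (Fin k)) (diam U / 2)) := measure_mono hsub
    _ = ENNReal.ofReal ((diam U / 2) ^ k) * ENNReal.ofReal (unitBallVol k) :=
        volume_closedBall_eq_unitBallVol _ (by positivity)
    _ = ENNReal.ofReal (unitBallVol k / 2 ^ k) * ENNReal.ofReal (diam U) ^ k := by
        rw [← ENNReal.ofReal_pow diam_nonneg, ← ENNReal.ofReal_mul (by positivity),
          ← ENNReal.ofReal_mul (by have := unitBallVol_pos k; positivity)]
        congr 1
        rw [div_pow]
        field_simp
    _ = _ := by rw [diam, ENNReal.ofReal_toReal hU]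

theorem volume_le_normHausdorff (n : ℕ) :
    (volume : Measure (EuclideanSpace ℝ (Fin n))) ≤ normHausdorff n n := by
  set c := ENNReal.ofReal (unitBallVol n / 2 ^ n) with hc
  have hc0 : c ≠ 0 := by
    have := unitBallVol_pos n
    simp only [hc, ne_eq, ENNReal.ofReal_eq_zero, not_le]
    positivity
  have hct : c ≠ ⊤ := ENNReal.ofReal_ne_top
  have h : c⁻¹ • (volume : Measure (EuclideanSpace ℝ (Fin n))) ≤ μH[(n : ℝ)] := by
    refine Measure.le_hausdorffMeasure _ _ 1 one_pos fun s hs => ?_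
    rw [Measure.smul_apply, smul_eq_mul, ENNReal.rpow_natCast]
    calc c⁻¹ * volume s ≤ c⁻¹ * (c * ediam s ^ n) := by
          gcongr
          exact volume_le_unitBallVol_mul_ediam_pow s (ne_top_of_le_ne_top ENNReal.one_ne_top hs)
      _ = ediam s ^ n := by rw [← mul_assoc, ENNReal.inv_mul_cancel hc0 hct, one_mul]
  refine Measure.le_iff'.2 fun s => ?_
  calc volume s = c * (c⁻¹ * volume s) := by
        rw [← mul_assoc, ENNReal.mul_inv_cancel hc0 hct, one_mul]
    _ ≤ c * μH[(n : ℝ)] s := by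
        gcongr
        exact h s
    _ = normHausdorff n n s := by simp [normHausdorff, hc]

/-- The Vitali-type covering bound for the Hausdorff measure. -/
theorem normHausdorff_le_volume (m : ℕ) :
    normHausdorff m m ≤ (volume : Measure (EuclideanSpace ℝ (Fin m))) := by
  refine Measure.le_iff'.2 fun s => ?_
  set c := ENNReal.ofReal (unitBallVol m / 2 ^ m) with hc
  have hc0 : c ≠ 0 := by
    have := unitBallVol_pos m
    simp only [hc, ne_eq, ENNReal.ofReal_eq_zero, not_le]
    positivity
  have hct : c ≠ ⊤ := ENNReal.ofReal_ne_top
  suffices h : μH[(m : ℝ)] s ≤ c⁻¹ * volume s by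
    calc normHausdorff m m s = c * μH[(m : ℝ)] s := by simp [normHausdorff, hc]
      _ ≤ c * (c⁻¹ * volume s) := by gcongr
      _ = volume s := by rw [← mul_assoc, ENNReal.mul_inv_cancel hc0 hct, one_mul]
  have hex : ∀ j : ℕ, ∃ (t : Set (EuclideanSpace ℝ (Fin m))) (r : EuclideanSpace ℝ (Fin m) → ℝ),
      t.Countable ∧ (∀ x ∈ t, r x ∈ Ioo (0 : ℝ) (1 / (j + 1))) ∧
      (s ⊆ ⋃ x ∈ t, closedBall x (r x)) ∧
      (∑' x : t, volume (closedBall (x : EuclideanSpace ℝ (Fin m)) (r x)))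
        ≤ volume s + ENNReal.ofReal (1 / (j + 1)) := by
    intro j
    obtain ⟨t, r, ht, -, hr, hs, hsum⟩ := Besicovitch.exists_closedBall_covering_tsum_measure_le
      (volume : Measure (EuclideanSpace ℝ (Fin m))) (ε := ENNReal.ofReal (1 / (j + 1)))
      (ENNReal.ofReal_pos.2 (by positivity)).ne' (fun _ => Ioo (0 : ℝ) (1 / (j + 1))) s
      (fun x _ δ hδ => by
        have : (0 : ℝ) < min (1 / ((j : ℝ) + 1)) δ := lt_min (by positivity) hδ
        exact ⟨min (1 / ((j : ℝ) + 1)) δ / 2,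
          ⟨by linarith, by linarith [min_le_left (1 / ((j : ℝ) + 1)) δ]⟩,
          ⟨by linarith, by linarith [min_le_right (1 / ((j : ℝ) + 1)) δ]⟩⟩)
    exact ⟨t, r, ht, hr, hs, hsum⟩
  choose t r ht hr hs hsum using hex
  have : ∀ j, Countable (t j) := fun j => (ht j).to_subtype
  have htend : Tendsto (fun j : ℕ => ENNReal.ofReal (1 / ((j : ℝ) + 1))) atTop (nhds 0) := by
    rw [← ENNReal.ofReal_zero]
    exact ENNReal.tendsto_ofReal tendsto_one_div_add_atTop_nhds_zero_nat
  have hdiam : ∀ (x : EuclideanSpace ℝ (Fin m)) (ρ : ℝ), 0 ≤ ρ →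
      ediam (closedBall x ρ) ≤ ENNReal.ofReal (2 * ρ) := fun x ρ _ => by
    refine ediam_le fun y hy z hz => ?_
    rw [edist_dist]
    refine ENNReal.ofReal_le_ofReal ((dist_triangle_right y z x).trans ?_)
    linarith [mem_closedBall.1 hy, mem_closedBall.1 hz]
  refine (Measure.hausdorffMeasure_le_liminf_tsum (m : ℝ) s (l := atTop)
    (fun j : ℕ => ENNReal.ofReal 2 * ENNReal.ofReal (1 / ((j : ℝ) + 1))) ?_
    (fun j (x : t j) => closedBall (x : EuclideanSpace ℝ (Fin m)) (r j x)) ?_ ?_).trans ?_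
  · have := ENNReal.Tendsto.const_mul (a := ENNReal.ofReal 2) htend (Or.inr ENNReal.ofReal_ne_top)
    simpa using this
  · refine Eventually.of_forall fun j x => (hdiam _ _ (hr j x x.2).1.le).trans ?_
    rw [← ENNReal.ofReal_mul zero_le_two]
    exact ENNReal.ofReal_le_ofReal (by linarith [(hr j x x.2).2])
  · refine Eventually.of_forall fun j => (hs j).trans ?_
    rw [biUnion_eq_iUnion]
  · have hle : ∀ j : ℕ, ∑' x : t j, ediam (closedBall (x : EuclideanSpace ℝ (Fin m)) (r j x)) ^ (m : ℝ)
        ≤ c⁻¹ * (volume s + ENNReal.ofReal (1 / (j + 1))) := by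
      intro j
      refine le_trans ?_ (mul_le_mul_right (hsum j) _)
      rw [← ENNReal.tsum_mul_left]
      refine ENNReal.tsum_le_tsum fun x => ?_
      have hrx := (hr j x x.2).1.le
      rw [ENNReal.rpow_natCast, volume_closedBall_eq_unitBallVol _ hrx]
      have h1 : ENNReal.ofReal (r j x ^ m) * ENNReal.ofReal (unitBallVol m)
          = c * ENNReal.ofReal (2 * r j x) ^ m := by
        rw [hc, ← ENNReal.ofReal_pow (by positivity), ← ENNReal.ofReal_mul (by positivity),
          ← ENNReal.ofReal_mul (by have := unitBallVol_pos m; positivity)]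
        congr 1
        rw [mul_pow]
        field_simp
      rw [h1, ← mul_assoc, ENNReal.inv_mul_cancel hc0 hct, one_mul]
      gcongr
      exact hdiam _ _ hrx
    have hlim : Tendsto (fun j : ℕ => c⁻¹ * (volume s + ENNReal.ofReal (1 / ((j : ℝ) + 1)))) atTop
        (nhds (c⁻¹ * volume s)) := by
      refine ENNReal.Tendsto.const_mul ?_ (Or.inr (ENNReal.inv_ne_top.2 hc0))
      simpa using tendsto_const_nhds.add htend
    rw [← hlim.liminf_eq]
    exact liminf_le_liminf (Eventually.of_forall hle)

theorem hausdorffMeasure_image_le_of_dist_le {X Y Z : Type*} [MetricSpace Y] [MetricSpace Z]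
    [MeasurableSpace Y] [BorelSpace Y] [MeasurableSpace Z] [BorelSpace Z]
    {f : X → Y} {g : X → Z} {s : Set X} {K : NNReal} {d : ℝ} (hd : 0 ≤ d)
    (h : ∀ x ∈ s, ∀ y ∈ s, dist (f x) (f y) ≤ K * dist (g x) (g y)) :
    μH[d] (f '' s) ≤ (K : ENNReal) ^ d * μH[d] (g '' s) := by
  rcases s.eq_empty_or_nonempty with rfl | ⟨x₀, -⟩
  · simp
  have : Nonempty X := ⟨x₀⟩
  have hinv : ∀ x ∈ s, g (Function.invFunOn g s (g x)) = g x ∧ Function.invFunOn g s (g x) ∈ s :=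
    fun x hx => ⟨Function.invFunOn_eq ⟨x, hx, rfl⟩, Function.invFunOn_mem ⟨x, hx, rfl⟩⟩
  have hlip : LipschitzOnWith K (f ∘ Function.invFunOn g s) (g '' s) := by
    refine LipschitzOnWith.of_dist_le_mul ?_
    rintro _ ⟨x, hx, rfl⟩ _ ⟨y, hy, rfl⟩
    have := h _ (hinv x hx).2 _ (hinv y hy).2
    rwa [(hinv x hx).1, (hinv y hy).1] at this
  have himg : f '' s ⊆ (f ∘ Function.invFunOn g s) '' (g '' s) := by
    rintro _ ⟨x, hx, rfl⟩
    refine ⟨g x, ⟨x, hx, rfl⟩, ?_⟩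
    have := h _ (hinv x hx).2 x hx
    rw [(hinv x hx).1, dist_self, mul_zero] at this
    exact dist_le_zero.1 this
  exact (measure_mono himg).trans (hlip.hausdorffMeasure_image_le hd)

theorem normHausdorff_image_le {X : Type*} {m n : ℕ} {f : X → EuclideanSpace ℝ (Fin n)}
    {g : X → EuclideanSpace ℝ (Fin m)} {s : Set X} {K : NNReal}
    (h : ∀ x ∈ s, ∀ y ∈ s, dist (f x) (f y) ≤ K * dist (g x) (g y)) :
    normHausdorff n m (f '' s) ≤ (K : ENNReal) ^ m * volume (g '' s) := by
  have h := hausdorffMeasure_image_le_of_dist_le (Nat.cast_nonneg m) h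
  rw [ENNReal.rpow_natCast] at h
  calc normHausdorff n m (f '' s)
      ≤ ENNReal.ofReal (unitBallVol m / 2 ^ m) * ((K : ENNReal) ^ m * μH[(m : ℝ)] (g '' s)) := by
        rw [normHausdorff, Measure.smul_apply, smul_eq_mul]
        gcongr
    _ = (K : ENNReal) ^ m * normHausdorff m m (g '' s) := by
        rw [normHausdorff, Measure.smul_apply, smul_eq_mul, mul_left_comm]
    _ ≤ _ := by
        gcongr
        exact normHausdorff_le_volume m

section Flat

variable {m n k : ℕ}

/-- The first `m` coordinates with respect to an orthonormal basis. -/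
def coordFst (b : OrthonormalBasis (Fin m ⊕ Fin k) ℝ (EuclideanSpace ℝ (Fin n)))
    (x : EuclideanSpace ℝ (Fin n)) : EuclideanSpace ℝ (Fin m) :=
  WithLp.toLp 2 fun i => b.repr x (Sum.inl i)

/-- The last `k` coordinates with respect to an orthonormal basis. -/
def coordSnd (b : OrthonormalBasis (Fin m ⊕ Fin k) ℝ (EuclideanSpace ℝ (Fin n)))
    (x : EuclideanSpace ℝ (Fin n)) : EuclideanSpace ℝ (Fin k) :=
  WithLp.toLp 2 fun i => b.repr x (Sum.inr i)

variable (b : OrthonormalBasis (Fin m ⊕ Fin k) ℝ (EuclideanSpace ℝ (Fin n)))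

theorem coordFst_sub (x y : EuclideanSpace ℝ (Fin n)) :
    coordFst b (x - y) = coordFst b x - coordFst b y := by
  ext i; simp [coordFst]

theorem coordSnd_sub (x y : EuclideanSpace ℝ (Fin n)) :
    coordSnd b (x - y) = coordSnd b x - coordSnd b y := by
  ext i; simp [coordSnd]

theorem norm_sq_eq_coord (x : EuclideanSpace ℝ (Fin n)) :
    ‖x‖ ^ 2 = ‖coordFst b x‖ ^ 2 + ‖coordSnd b x‖ ^ 2 := by
  rw [← b.repr.norm_map x, EuclideanSpace.norm_sq_eq, Fintype.sum_sum_type]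
  simp [EuclideanSpace.norm_sq_eq, coordFst, coordSnd]

theorem norm_coordFst_le (x : EuclideanSpace ℝ (Fin n)) : ‖coordFst b x‖ ≤ ‖x‖ := by
  rw [← sq_le_sq₀ (norm_nonneg _) (norm_nonneg _), norm_sq_eq_coord b x]
  exact le_add_of_nonneg_right (sq_nonneg _)

theorem continuous_coordFst : Continuous (coordFst b) := by
  unfold coordFst
  fun_prop

theorem measurePreserving_coord :
    MeasurePreserving (fun x => (coordFst b x, coordSnd b x)) volume
      ((volume : Measure (EuclideanSpace ℝ (Fin m))).prod
        (volume : Measure (EuclideanSpace ℝ (Fin k)))) := by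
  have h1 := b.repr.measurePreserving
  have h2 := PiLp.volume_preserving_ofLp (Fin m ⊕ Fin k)
  have h3 := volume_measurePreserving_sumPiEquivProdPi (fun _ : Fin m ⊕ Fin k => ℝ)
  have h4 := (PiLp.volume_preserving_toLp (Fin m)).prod (PiLp.volume_preserving_toLp (Fin k))
  exact h4.comp (h3.comp (h2.comp h1))

theorem volume_coordFst_image_mul_le (S : Set (EuclideanSpace ℝ (Fin n))) {r : ℝ} (hr : 0 < r) :
    volume (coordFst b '' S) * ENNReal.ofReal (unitBallVol k * r ^ k)
      ≤ volume (⋃ x ∈ S, ball x r) := by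
  set W : Set (EuclideanSpace ℝ (Fin m) × EuclideanSpace ℝ (Fin k)) :=
    ⋃ x ∈ S, {p | ‖p.1 - coordFst b x‖ ^ 2 + ‖p.2 - coordSnd b x‖ ^ 2 < r ^ 2} with hW
  have hWo : IsOpen W := by
    refine isOpen_biUnion fun x _ => isOpen_lt ?_ continuous_const
    fun_prop
  have hpre : (fun x => (coordFst b x, coordSnd b x)) ⁻¹' W = ⋃ x ∈ S, ball x r := by
    ext y
    simp only [hW, mem_preimage, mem_iUnion, mem_ofPred_eq, mem_ball, dist_eq_norm, exists_prop]
    refine exists_congr fun x => and_congr_right fun _ => ?_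
    rw [← coordFst_sub, ← coordSnd_sub, ← norm_sq_eq_coord, sq_lt_sq₀ (norm_nonneg _) hr.le]
  rw [← hpre, (measurePreserving_coord b).measure_preimage hWo.measurableSet.nullMeasurableSet,
    Measure.prod_apply hWo.measurableSet, mul_comm]
  refine le_trans ?_ (mul_meas_ge_le_lintegral (measurable_measure_prodMk_left hWo.measurableSet)
    (ENNReal.ofReal (unitBallVol k * r ^ k)))
  gcongr
  rintro _ ⟨x, hx, rfl⟩
  have hsub : ball (coordSnd b x) r ⊆ Prod.mk (coordFst b x) ⁻¹' W := by
    intro z hz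
    simp only [hW, mem_preimage, mem_iUnion, mem_ofPred_eq, exists_prop]
    refine ⟨x, hx, ?_⟩
    rw [mem_ball, dist_eq_norm] at hz
    simpa using pow_lt_pow_left₀ hz (norm_nonneg _) two_ne_zero
  refine le_trans (le_of_eq ?_) (measure_mono hsub)
  rw [volume_ball_eq_unitBallVol _ hr, mul_comm (unitBallVol k),
    ENNReal.ofReal_mul (by positivity)]

/-- A set on which some orthogonal projection onto an `m`-plane shrinks distances by at most
the factor `L`. -/
def AlmostFlat (m k : ℕ) (L : NNReal) (C : Set (EuclideanSpace ℝ (Fin n))) : Prop :=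
  ∃ b : OrthonormalBasis (Fin m ⊕ Fin k) ℝ (EuclideanSpace ℝ (Fin n)),
    ∀ x ∈ C, ∀ y ∈ C, dist x y ≤ L * dist (coordFst b x) (coordFst b y)

theorem mk_mem_closure_prod {X Y : Type*} [TopologicalSpace X] [TopologicalSpace Y] {s : Set X}
    {t : Set Y} {x : X} {y : Y} (hx : x ∈ closure s) (hy : y ∈ closure t) :
    (x, y) ∈ closure (s ×ˢ t) := by
  rw [closure_prod_eq]
  exact ⟨hx, hy⟩

theorem isClosed_dist_le_mul_dist_coordFst (L : NNReal) :
    IsClosed {p : EuclideanSpace ℝ (Fin n) × EuclideanSpace ℝ (Fin n) |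
      dist p.1 p.2 ≤ L * dist (coordFst b p.1) (coordFst b p.2)} := by
  have hc := continuous_coordFst b
  have h1 : Continuous fun p : EuclideanSpace ℝ (Fin n) × EuclideanSpace ℝ (Fin n) =>
    dist p.1 p.2 := continuous_dist
  have h2 : Continuous fun p : EuclideanSpace ℝ (Fin n) × EuclideanSpace ℝ (Fin n) =>
    dist (coordFst b p.1) (coordFst b p.2) :=
      (hc.comp continuous_fst).dist (hc.comp continuous_snd)
  exact isClosed_le h1 (continuous_const.mul h2)

theorem dist_le_mul_dist_coordFst_closure {L : NNReal} {C : Set (EuclideanSpace ℝ (Fin n))}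
    (hb : ∀ x ∈ C, ∀ y ∈ C, dist x y ≤ L * dist (coordFst b x) (coordFst b y)) :
    ∀ x ∈ closure C, ∀ y ∈ closure C, dist x y ≤ L * dist (coordFst b x) (coordFst b y) := by
  intro x hx y hy
  have h := closure_minimal (s := C ×ˢ C) (fun p hp => hb p.1 hp.1 p.2 hp.2)
    (isClosed_dist_le_mul_dist_coordFst b L) (mk_mem_closure_prod hx hy)
  exact h

theorem almostFlat_closure {L : NNReal} {C : Set (EuclideanSpace ℝ (Fin n))}
    (h : AlmostFlat m k L C) : AlmostFlat m k L (closure C) := by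
  obtain ⟨b, hb⟩ := h
  exact ⟨b, dist_le_mul_dist_coordFst_closure b hb⟩

theorem normHausdorff_le_pow_mul_volume {L : NNReal} {S : Set (EuclideanSpace ℝ (Fin n))}
    (hb : ∀ x ∈ S, ∀ y ∈ S, dist x y ≤ L * dist (coordFst b x) (coordFst b y)) :
    normHausdorff n m S ≤ (L : ENNReal) ^ m * volume (coordFst b '' S) := by
  simpa only [image_id] using normHausdorff_image_le (f := id) (g := coordFst b) hb

theorem AlmostFlat.normHausdorff_mul_le {L : NNReal} {C S : Set (EuclideanSpace ℝ (Fin n))}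
    (h : AlmostFlat m k L C) (hS : S ⊆ C) {r : ℝ} (hr : 0 < r) :
    normHausdorff n m S * ENNReal.ofReal (unitBallVol k * r ^ k)
      ≤ (L : ENNReal) ^ m * volume (⋃ x ∈ S, ball x r) := by
  obtain ⟨b, hb⟩ := h
  calc _ ≤ ((L : ENNReal) ^ m * volume (coordFst b '' S)) * _ := by
        gcongr
        exact normHausdorff_le_pow_mul_volume b fun x hx y hy => hb x (hS hx) y (hS hy)
    _ ≤ _ := by
        rw [mul_assoc]
        gcongr
        exact volume_coordFst_image_mul_le b S hr

theorem AlmostFlat.normHausdorff_lt_top {L : NNReal} {C : Set (EuclideanSpace ℝ (Fin n))}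
    (h : AlmostFlat m k L C) (hC : Bornology.IsBounded C) : normHausdorff n m C < ⊤ := by
  obtain ⟨b, hb⟩ := h
  refine (normHausdorff_le_pow_mul_volume b hb).trans_lt ?_
  refine ENNReal.mul_lt_top (by simp) (Bornology.IsBounded.measure_lt_top ?_)
  have hlip : LipschitzWith 1 (coordFst b) := LipschitzWith.of_dist_le_mul fun x y => by
    rw [dist_eq_norm, ← coordFst_sub, NNReal.coe_one, one_mul, dist_eq_norm]
    exact norm_coordFst_le b _
  exact hlip.isBounded_image hC

end Flat

theorem exists_det_le_of_apply_eq_zero {F G : Type*} [NormedAddCommGroup F] [InnerProductSpace ℝ F]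
    [FiniteDimensional ℝ F] [NormedAddCommGroup G] [NormedSpace ℝ G] (A : F →L[ℝ] G)
    {v : F} (hv : v ≠ 0) (hAv : A v = 0) {η : ENNReal} (hη : 0 < η) :
    ∃ (δ : NNReal) (T : F →L[ℝ] F), δ ≠ 0 ∧ ENNReal.ofReal |T.det| ≤ η ∧
      ∀ x, ‖A x‖ + δ * ‖x‖ ≤ 2 * ‖T x‖ := by
  wlog hv1 : ‖v‖ = 1 generalizing v
  · refine this (v := ‖v‖⁻¹ • v) ?_ (by simp [hAv]) (by simp [norm_smul, hv])
    simp [hv]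
  set Q : F →L[ℝ] F := ContinuousLinearMap.id ℝ F - (innerSL ℝ v).smulRight v with hQ
  have hQapp : ∀ x, Q x = x - inner ℝ v x • v := fun x => by simp [hQ]
  have hQv : Q v = 0 := by simp [hQapp, hv1]
  have hQorth : ∀ x, inner ℝ v (Q x) = 0 := fun x => by
    simp [hQapp, inner_sub_right, inner_smul_right, hv1]
  set T : ℝ → F →L[ℝ] F := fun δ => δ • ContinuousLinearMap.id ℝ F + ‖A‖ • Q with hT
  have hcont : Continuous fun δ => ENNReal.ofReal |(T δ).det| := by
    refine ENNReal.continuous_ofReal.comp (continuous_abs.comp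
      (ContinuousLinearMap.continuous_det.comp ?_))
    fun_prop
  have h0 : (T 0).det = 0 := by
    by_contra hdet
    have hinj : Function.Injective (T 0) :=
      ((LinearMap.isUnit_iff_isUnit_det _).2 (isUnit_iff_ne_zero.2 hdet) |>
        (Module.End.isUnit_iff _).1).1
    refine hv (hinj ?_)
    simp [hT, hQv]
  have hev : ∀ᶠ δ in nhdsWithin (0 : ℝ) (Ioi 0), ENNReal.ofReal |(T δ).det| < η := by
    refine (hcont.tendsto 0).mono_left nhdsWithin_le_nhds |>.eventually_lt_const ?_
    simpa [h0] using hη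
  obtain ⟨δ, hδ, hδ0⟩ := (hev.and self_mem_nhdsWithin).exists
  have hδ0 : 0 < δ := hδ0
  refine ⟨⟨δ, hδ0.le⟩, T δ, fun h => hδ0.ne' (congrArg NNReal.toReal h), hδ.le, fun x => ?_⟩
  have hx : x = inner ℝ v x • v + Q x := by rw [hQapp]; abel
  have hTx : T δ x = (δ * inner ℝ v x) • v + (δ + ‖A‖) • Q x := by
    simp only [hT, hQapp, add_apply, smul_apply,
      ContinuousLinearMap.id_apply]
    module
  have hnorm : ‖T δ x‖ ^ 2 = (δ * |inner ℝ v x|) ^ 2 + ((δ + ‖A‖) * ‖Q x‖) ^ 2 := by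
    rw [hTx, sq, norm_add_sq_eq_norm_sq_add_norm_sq_real
      (by rw [inner_smul_left, inner_smul_right, hQorth]; simp), norm_smul, norm_smul, hv1,
      norm_mul, Real.norm_of_nonneg hδ0.le, Real.norm_of_nonneg (add_nonneg hδ0.le (norm_nonneg A)),
      Real.norm_eq_abs]
    ring
  have h1 : δ * |inner ℝ v x| ≤ ‖T δ x‖ := by
    refine (pow_le_pow_iff_left₀ (by positivity) (norm_nonneg _) two_ne_zero).1 ?_
    rw [hnorm]
    exact le_add_of_nonneg_right (sq_nonneg _)
  have h2 : (δ + ‖A‖) * ‖Q x‖ ≤ ‖T δ x‖ := by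
    refine (pow_le_pow_iff_left₀ (by positivity) (norm_nonneg _) two_ne_zero).1 ?_
    rw [hnorm]
    exact le_add_of_nonneg_left (sq_nonneg _)
  have h3 : ‖A x‖ ≤ ‖A‖ * ‖Q x‖ := by
    have : A x = A (Q x) := by
      conv_lhs => rw [hx]
      simp [hAv]
    rw [this]
    exact A.le_opNorm _
  have h4 : ‖x‖ ≤ |inner ℝ v x| + ‖Q x‖ := by
    conv_lhs => rw [hx]
    refine (norm_add_le _ _).trans ?_
    simp [norm_smul, hv1]
  have h5 := mul_le_mul_of_nonneg_left h4 hδ0.le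
  change ‖A x‖ + δ * ‖x‖ ≤ 2 * ‖T δ x‖
  linarith

theorem normHausdorff_image_eq_zero_of_not_injective {m n : ℕ}
    {f : EuclideanSpace ℝ (Fin m) → EuclideanSpace ℝ (Fin n)} {s : Set (EuclideanSpace ℝ (Fin m))}
    (hs : volume s ≠ ⊤)
    {f' : EuclideanSpace ℝ (Fin m) → EuclideanSpace ℝ (Fin m) →L[ℝ] EuclideanSpace ℝ (Fin n)}
    (hf' : ∀ x ∈ s, HasFDerivWithinAt f (f' x) s x)
    (hinj : ∀ x ∈ s, ¬ Function.Injective (f' x)) :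
    normHausdorff n m (f '' s) = 0 := by
  rcases s.eq_empty_or_nonempty with rfl | hne
  · simp
  have key : ∀ η : ENNReal, 0 < η → normHausdorff n m (f '' s) ≤ η * (2 ^ m * volume s) := by
    intro η hη
    have hex : ∀ A : EuclideanSpace ℝ (Fin m) →L[ℝ] EuclideanSpace ℝ (Fin n),
        ∃ (δ : NNReal), δ ≠ 0 ∧ (¬ Function.Injective A →
          ∃ T : EuclideanSpace ℝ (Fin m) →L[ℝ] EuclideanSpace ℝ (Fin m),
            ENNReal.ofReal |T.det| ≤ η ∧ ∀ x, ‖A x‖ + δ * ‖x‖ ≤ 2 * ‖T x‖) := by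
      intro A
      by_cases hA : Function.Injective A
      · exact ⟨1, one_ne_zero, fun h => (h hA).elim⟩
      · rw [injective_iff_map_eq_zero] at hA
        push Not at hA
        obtain ⟨v, hAv, hv⟩ := hA
        obtain ⟨δ, T, hδ, hT⟩ := exists_det_le_of_apply_eq_zero A hv hAv hη
        exact ⟨δ, hδ, fun _ => ⟨T, hT⟩⟩
    choose δ hδ hT using hex
    obtain ⟨t, A, hdisj, htm, hst, happ, hA⟩ :=
      exists_partition_approximatesLinearOn_of_hasFDerivWithinAt f s f' hf' δ hδ
    have hpiece : ∀ i, normHausdorff n m (f '' (s ∩ t i)) ≤ 2 ^ m * (η * volume (s ∩ t i)) := by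
      intro i
      obtain ⟨y, hy, hAy⟩ := hA hne i
      obtain ⟨T, hdet, hTle⟩ := hT (A i) (hAy ▸ hinj y hy)
      refine (normHausdorff_image_le (g := T) (K := 2) fun x hx y hy => ?_).trans ?_
      · have := happ i x hx y hy
        rw [dist_eq_norm, dist_eq_norm, ← map_sub]
        have h2 := hTle (x - y)
        have h3 := norm_sub_norm_le (f x - f y) (A i (x - y))
        rw [NNReal.coe_ofNat]
        linarith
      · rw [Measure.addHaar_image_continuousLinearMap]
        push_cast
        gcongr
    calc normHausdorff n m (f '' s) ≤ normHausdorff n m (⋃ i, f '' (s ∩ t i)) := by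
          refine measure_mono ?_
          rw [← image_iUnion, ← inter_iUnion]
          exact image_mono (subset_inter subset_rfl hst)
      _ ≤ ∑' i, normHausdorff n m (f '' (s ∩ t i)) := measure_iUnion_le _
      _ ≤ ∑' i, 2 ^ m * (η * volume (s ∩ t i)) := ENNReal.tsum_le_tsum hpiece
      _ = 2 ^ m * (η * ∑' i, volume.restrict s (t i)) := by
          simp_rw [ENNReal.tsum_mul_left, Measure.restrict_apply (htm _), inter_comm]
      _ ≤ 2 ^ m * (η * volume s) := by
          rw [← measure_iUnion hdisj htm]
          refine mul_le_mul_right (mul_le_mul_right ?_ _) _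
          exact (measure_mono (subset_univ _)).trans (Measure.restrict_apply_univ s).le
      _ = η * (2 ^ m * volume s) := by ring
  have hfin : (2 : ENNReal) ^ m * volume s ≠ ⊤ := ENNReal.mul_ne_top (by simp) hs
  have hlim : Tendsto (fun η : ENNReal => η * (2 ^ m * volume s)) (nhdsWithin 0 (Ioi 0))
      (nhds 0) := by
    have := (ENNReal.Tendsto.mul_const (b := 2 ^ m * volume s) tendsto_id (Or.inr hfin)).mono_left
      (nhdsWithin_le_nhds (a := (0 : ENNReal)) (s := Ioi 0))
    simpa using this
  exact le_antisymm (ge_of_tendsto hlim (eventually_mem_nhdsWithin.mono key)) zero_le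

theorem exists_orthonormalBasis_coordSnd_eq_zero {m n k : ℕ} (hmk : m + k = n)
    (A : EuclideanSpace ℝ (Fin m) →L[ℝ] EuclideanSpace ℝ (Fin n)) (hA : Function.Injective A) :
    ∃ b : OrthonormalBasis (Fin m ⊕ Fin k) ℝ (EuclideanSpace ℝ (Fin n)),
      ∀ x, coordSnd b (A x) = 0 := by
  have hrank : Module.finrank ℝ (LinearMap.range A.toLinearMap) = m := by
    rw [LinearMap.finrank_range_of_inj hA, finrank_euclideanSpace_fin]
  let w := (stdOrthonormalBasis ℝ (LinearMap.range A.toLinearMap)).reindex (finCongr hrank)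
  let v : Fin m ⊕ Fin k → EuclideanSpace ℝ (Fin n) := Sum.elim (fun i => (w i : _)) 0
  have hv : Orthonormal ℝ ((range (Sum.inl : Fin m → Fin m ⊕ Fin k)).domRestrict v) := by
    have hw : Orthonormal ℝ fun i => (w i : EuclideanSpace ℝ (Fin n)) :=
      w.orthonormal.comp_linearIsometry (LinearMap.range A.toLinearMap).subtypeₗᵢ
    refine ⟨?_, ?_⟩
    · rintro ⟨_, i, rfl⟩
      exact hw.1 i
    · rintro ⟨_, i, rfl⟩ ⟨_, j, rfl⟩ hij
      refine hw.2 (i := i) (j := j) fun h => hij ?_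
      subst h
      rfl
  obtain ⟨b, hb⟩ := hv.exists_orthonormalBasis_extension_of_card_eq (by simp [hmk])
  refine ⟨b, fun x => ?_⟩
  ext j
  have hx := congrArg Subtype.val (w.sum_repr' ⟨A x, ⟨x, rfl⟩⟩)
  have hwb : ∀ i, (w i : EuclideanSpace ℝ (Fin n)) = b (Sum.inl i) := fun i =>
    (hb _ ⟨i, rfl⟩).symm
  simp only [Submodule.coe_sum, Submodule.coe_smul, hwb] at hx
  simp only [coordSnd, b.repr_apply_apply]
  rw [← hx, inner_sum]
  refine Finset.sum_eq_zero fun i _ => ?_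
  rw [inner_smul_right, b.orthonormal.2 (by simp), mul_zero]

theorem exists_almostFlat_of_approximatesLinearOn {m n k : ℕ} (hmk : m + k = n)
    {A : EuclideanSpace ℝ (Fin m) →L[ℝ] EuclideanSpace ℝ (Fin n)} (hA : Function.Injective A)
    {L : NNReal} (hL : 1 < L) :
    ∃ δ : NNReal, δ ≠ 0 ∧ ∀ (f : EuclideanSpace ℝ (Fin m) → EuclideanSpace ℝ (Fin n))
      (s : Set (EuclideanSpace ℝ (Fin m))), ApproximatesLinearOn f A s δ →
        AlmostFlat m k L (f '' s) := by
  obtain ⟨b, hb⟩ := exists_orthonormalBasis_coordSnd_eq_zero hmk A hA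
  obtain ⟨K, hK, hanti⟩ := A.toLinearMap.exists_antilipschitzWith (LinearMap.ker_eq_bot.2 hA)
  have hL' : (1 : ℝ) < L := hL
  set ε : ℝ := (L - 1) / (L + 1) with hε
  have hε0 : 0 < ε := div_pos (by linarith) (by linarith)
  have hK' : (0 : ℝ) < K := hK
  have hδ0 : 0 < ε / K := by positivity
  refine ⟨⟨ε / K, hδ0.le⟩, fun h => hδ0.ne' (congrArg NNReal.toReal h), fun f s hf => ⟨b, ?_⟩⟩
  rintro _ ⟨x, hx, rfl⟩ _ ⟨y, hy, rfl⟩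
  have hxy := hf x hx y hy
  change ‖f x - f y - A (x - y)‖ ≤ ε / K * ‖x - y‖ at hxy
  have hz : ‖x - y‖ ≤ K * ‖A (x - y)‖ := by
    have := hanti.le_mul_dist x y
    rwa [dist_eq_norm, dist_eq_norm, ← map_sub] at this
  have herr : ‖f x - f y - A (x - y)‖ ≤ ε * ‖A (x - y)‖ := by
    refine hxy.trans ((mul_le_mul_of_nonneg_left hz hδ0.le).trans_eq ?_)
    field_simp
  have hAn : ‖coordFst b (A (x - y))‖ = ‖A (x - y)‖ := by
    have := norm_sq_eq_coord b (A (x - y))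
    rw [hb, norm_zero, zero_pow two_ne_zero, add_zero] at this
    exact ((sq_eq_sq₀ (norm_nonneg _) (norm_nonneg _)).1 this).symm
  have hup : ‖f x - f y‖ ≤ (1 + ε) * ‖A (x - y)‖ := by
    linarith [norm_sub_norm_le (f x - f y) (A (x - y))]
  have hlow : (1 - ε) * ‖A (x - y)‖ ≤ ‖coordFst b (f x - f y)‖ := by
    have h1 := norm_coordFst_le b (f x - f y - A (x - y))
    rw [coordFst_sub] at h1
    have h2 := norm_sub_norm_le (coordFst b (A (x - y))) (coordFst b (f x - f y))
    rw [norm_sub_rev] at h2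
    linarith
  rw [dist_eq_norm, dist_eq_norm, ← coordFst_sub]
  have hLε : (L : ℝ) * (1 - ε) = 1 + ε := by
    rw [hε]
    field_simp
    ring
  calc ‖f x - f y‖ ≤ (1 + ε) * ‖A (x - y)‖ := hup
    _ = L * ((1 - ε) * ‖A (x - y)‖) := by rw [← mul_assoc, hLε]
    _ ≤ _ := by gcongr

theorem almostFlat_empty {m n k : ℕ} (hmk : m + k = n) (L : NNReal) :
    AlmostFlat m k L (∅ : Set (EuclideanSpace ℝ (Fin n))) :=
  ⟨(EuclideanSpace.basisFun (Fin n) ℝ).reindex ((finCongr hmk.symm).trans finSumFinEquiv.symm),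
    by simp⟩

theorem MRectifiable.exists_almostFlat {m n k : ℕ} (hmk : m + k = n)
    {S : Set (EuclideanSpace ℝ (Fin n))} (hS : MRectifiable m n S) {L : NNReal} (hL : 1 < L) :
    ∃ C : ℕ → Set (EuclideanSpace ℝ (Fin n)),
      (∀ i, IsClosed (C i) ∧ Bornology.IsBounded (C i) ∧ AlmostFlat m k L (C i)) ∧
      normHausdorff n m (S \ ⋃ i, C i) = 0 := by
  obtain ⟨F, Ψ, K, hF, hΨ, rfl⟩ := hS
  obtain ⟨f, hf, hfΨ⟩ := hΨ.extend_finite_dimension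
  rw [hfΨ.image_eq]
  generalize lipschitzExtensionConstant (EuclideanSpace ℝ (Fin n)) * K = K' at hf
  set N := F ∩ {x | ¬ DifferentiableAt ℝ f x} with hN
  set D₀ := F ∩ {x | DifferentiableAt ℝ f x ∧ ¬ Function.Injective (fderiv ℝ f x)} with hD₀
  set D₁ := F ∩ {x | DifferentiableAt ℝ f x ∧ Function.Injective (fderiv ℝ f x)} with hD₁
  have hN0 : normHausdorff n m (f '' N) = 0 := by
    have hvol : volume N = 0 := measure_mono_null inter_subset_right (ae_iff.1 hf.ae_differentiableAt)
    have := normHausdorff_image_le (f := f) (g := id) (s := N) (K := K')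
      fun x _ y _ => hf.dist_le_mul x y
    simpa [hvol] using this
  have hD₀0 : normHausdorff n m (f '' D₀) = 0 :=
    normHausdorff_image_eq_zero_of_not_injective (f' := fderiv ℝ f)
      (hF.subset inter_subset_left).measure_lt_top.ne
      (fun x hx => hx.2.1.hasFDerivAt.hasFDerivWithinAt) (fun x hx => hx.2.2)
  have hsplit : f '' F ⊆ f '' D₁ ∪ (f '' N ∪ f '' D₀) := by
    rw [← image_union, ← image_union]
    refine image_mono fun x hx => ?_
    by_cases h1 : DifferentiableAt ℝ f x
    · by_cases h2 : Function.Injective (fderiv ℝ f x)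
      · exact Or.inl ⟨hx, h1, h2⟩
      · exact Or.inr (Or.inr ⟨hx, h1, h2⟩)
    · exact Or.inr (Or.inl ⟨hx, h1⟩)
  suffices h : ∃ C : ℕ → Set (EuclideanSpace ℝ (Fin n)),
      (∀ i, IsClosed (C i) ∧ Bornology.IsBounded (C i) ∧ AlmostFlat m k L (C i)) ∧
      f '' D₁ ⊆ ⋃ i, C i by
    obtain ⟨C, hC, hsub⟩ := h
    refine ⟨C, hC, measure_mono_null ?_ (measure_union_null hN0 hD₀0)⟩
    rintro y ⟨hy, hyC⟩
    exact (hsplit hy).resolve_left fun h => hyC (hsub h)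
  rcases D₁.eq_empty_or_nonempty with hempty | hne
  · exact ⟨fun _ => ∅, fun _ => ⟨isClosed_empty, Bornology.isBounded_empty,
      almostFlat_empty hmk L⟩, by simp [hempty]⟩
  have hex : ∀ A : EuclideanSpace ℝ (Fin m) →L[ℝ] EuclideanSpace ℝ (Fin n),
      ∃ δ : NNReal, δ ≠ 0 ∧ (Function.Injective A →
        ∀ s : Set (EuclideanSpace ℝ (Fin m)), ApproximatesLinearOn f A s δ →
          AlmostFlat m k L (f '' s)) := by
    intro A
    by_cases hA : Function.Injective A
    · obtain ⟨δ, hδ, h⟩ := exists_almostFlat_of_approximatesLinearOn hmk hA hL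
      exact ⟨δ, hδ, fun _ => h f⟩
    · exact ⟨1, one_ne_zero, fun h => (hA h).elim⟩
  choose δ hδ hflat using hex
  obtain ⟨t, A, -, -, hst, happ, hA⟩ :=
    exists_partition_approximatesLinearOn_of_hasFDerivWithinAt f D₁ (fderiv ℝ f)
      (fun x hx => hx.2.1.hasFDerivAt.hasFDerivWithinAt) δ hδ
  refine ⟨fun i => closure (f '' (D₁ ∩ t i)), fun i => ⟨isClosed_closure, ?_, ?_⟩, ?_⟩
  · exact (hf.isBounded_image (hF.subset (inter_subset_left.trans inter_subset_left))).closure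
  · obtain ⟨y, hy, hAy⟩ := hA hne i
    exact almostFlat_closure (hflat (A i) (hAy ▸ hy.2.2) _ (happ i))
  · calc f '' D₁ ⊆ f '' ⋃ i, D₁ ∩ t i := by
          rw [← inter_iUnion]
          exact image_mono (subset_inter subset_rfl hst)
      _ = ⋃ i, f '' (D₁ ∩ t i) := image_iUnion
      _ ⊆ _ := iUnion_mono fun i => subset_closure

theorem HmRectifiable.exists_almostFlat {m n k : ℕ} (hmk : m + k = n)
    {E : Set (EuclideanSpace ℝ (Fin n))} (hE : HmRectifiable m n E) {L : NNReal} (hL : 1 < L) :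
    ∃ C : ℕ → Set (EuclideanSpace ℝ (Fin n)),
      (∀ i, IsClosed (C i) ∧ Bornology.IsBounded (C i) ∧ AlmostFlat m k L (C i)) ∧
      normHausdorff n m (E \ ⋃ i, C i) = 0 := by
  obtain ⟨_, ⟨F, hF, rfl⟩, hEF⟩ := hE
  choose C hC hnull using fun i => (hF i).exists_almostFlat hmk hL
  refine ⟨fun j => C j.unpair.1 j.unpair.2, fun j => hC _ _,
    measure_mono_null ?_ (measure_union_null hEF (measure_iUnion_null hnull))⟩
  rintro x ⟨hx, hxC⟩
  by_cases hxF : x ∈ ⋃ i, F i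
  · obtain ⟨i, hi⟩ := mem_iUnion.1 hxF
    refine Or.inr (mem_iUnion.2 ⟨i, hi, fun h => hxC ?_⟩)
    obtain ⟨j, hj⟩ := mem_iUnion.1 h
    exact mem_iUnion.2 ⟨Nat.pair i j, by simpa using hj⟩
  · exact Or.inl ⟨hx, hxF⟩

section Content

variable {m n k : ℕ} {ι : Type*} {L : NNReal} {E : Set (EuclideanSpace ℝ (Fin n))}
  {u : EuclideanSpace ℝ (Fin n) → ℝ} {B : ℝ} {I : Finset ι}
  {Q : ι → Set (EuclideanSpace ℝ (Fin n))} {ρ : ι → NNReal}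

theorem AlmostFlat.mono {C D : Set (EuclideanSpace ℝ (Fin n))} (h : AlmostFlat m k L C)
    (hDC : D ⊆ C) : AlmostFlat m k L D := by
  obtain ⟨b, hb⟩ := h
  exact ⟨b, fun x hx y hy => hb x (hDC hx) y (hDC hy)⟩

theorem eventually_disjoint_thickening {X : Type*} [PseudoEMetricSpace X] {s t : Set X}
    (hs : IsCompact s) (ht : IsClosed t) (hst : Disjoint s t) {B : ℝ} (hB : 0 < B) :
    ∀ᶠ r in nhdsWithin (0 : ℝ) (Ioi 0),
      Disjoint (thickening (B * r) s) (thickening (B * r) t) := by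
  obtain ⟨δ, hδ, hd⟩ := hst.exists_thickenings hs ht
  filter_upwards [Ioo_mem_nhdsGT (div_pos hδ hB)] with r hr
  have hr' : B * r ≤ δ := by
    rw [mul_comm]
    exact ((lt_div_iff₀ hB).1 hr.2).le
  exact hd.mono (thickening_mono hr' s) (thickening_mono hr' t)

theorem eventually_sum_mul_le_volume (hk : k ≠ 0) (hu : ∀ x, u x ≤ B)
    (hQ : ∀ i ∈ I, IsCompact (Q i)) (hdisj : (I : Set ι).PairwiseDisjoint Q)
    (hflat : ∀ i ∈ I, AlmostFlat m k L (Q i)) (hρ : ∀ i ∈ I, ∀ x ∈ Q i, (ρ i : ℝ) ≤ u x) :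
    ∀ᶠ r in nhdsWithin (0 : ℝ) (Ioi 0),
      (∑ i ∈ I, (ρ i : ENNReal) ^ k * normHausdorff n m (E ∩ Q i)) *
          ENNReal.ofReal (unitBallVol k * r ^ k)
        ≤ (L : ENNReal) ^ m * volume (⋃ x ∈ E, ball x (u x * r)) := by
  have hB : 0 < max B 1 := lt_max_of_lt_right one_pos
  have hev : ∀ᶠ r in nhdsWithin (0 : ℝ) (Ioi 0), ∀ i ∈ I, ∀ j ∈ I, i ≠ j →
      Disjoint (thickening (max B 1 * r) (Q i)) (thickening (max B 1 * r) (Q j)) := by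
    refine (Filter.eventually_all_finset I).2 fun i hi =>
      (Filter.eventually_all_finset I).2 fun j hj => ?_
    by_cases hij : i = j
    · exact Eventually.of_forall fun r h => (h hij).elim
    · exact (eventually_disjoint_thickening (hQ i hi) (hQ j hj).isClosed (hdisj hi hj hij)
        hB).mono fun r h _ => h
  filter_upwards [hev, self_mem_nhdsWithin] with r hr hr0
  have hr0 : 0 < r := hr0
  set V : ι → Set (EuclideanSpace ℝ (Fin n)) := fun i => ⋃ x ∈ E ∩ Q i, ball x (ρ i * r) with hV
  have hVthick : ∀ i ∈ I, V i ⊆ thickening (max B 1 * r) (Q i) := by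
    intro i hi
    refine iUnion₂_subset fun x hx => ?_
    refine (ball_subset_ball ?_).trans (ball_subset_thickening hx.2 _)
    gcongr
    exact ((hρ i hi x hx.2).trans (hu x)).trans (le_max_left _ _)
  have hVo : ∀ i, IsOpen (V i) := fun i => isOpen_biUnion fun x _ => isOpen_ball
  have hpiece : ∀ i ∈ I, (ρ i : ENNReal) ^ k * normHausdorff n m (E ∩ Q i) *
      ENNReal.ofReal (unitBallVol k * r ^ k) ≤ (L : ENNReal) ^ m * volume (V i) := by
    intro i hi
    rcases eq_or_ne (ρ i) 0 with h0 | h0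
    · simp [h0, hk]
    · have hpos : 0 < (ρ i : ℝ) := NNReal.coe_pos.2 (pos_iff_ne_zero.2 h0)
      refine le_trans (le_of_eq ?_)
        ((hflat i hi).normHausdorff_mul_le (S := E ∩ Q i) inter_subset_right (mul_pos hpos hr0))
      have : unitBallVol k * (ρ i * r) ^ k = (ρ i : ℝ) ^ k * (unitBallVol k * r ^ k) := by ring
      rw [this, ENNReal.ofReal_mul (p := (ρ i : ℝ) ^ k) (by positivity), ENNReal.ofReal_pow hpos.le,
        ENNReal.ofReal_coe_nnreal]
      ring
  calc _ = ∑ i ∈ I, (ρ i : ENNReal) ^ k * normHausdorff n m (E ∩ Q i) *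
      ENNReal.ofReal (unitBallVol k * r ^ k) := Finset.sum_mul _ _ _
    _ ≤ ∑ i ∈ I, (L : ENNReal) ^ m * volume (V i) := Finset.sum_le_sum hpiece
    _ = (L : ENNReal) ^ m * volume (⋃ i ∈ I, V i) := by
        rw [← Finset.mul_sum, measure_biUnion_finset _ fun i _ => (hVo i).measurableSet]
        intro i hi j hj hij
        exact (hr i hi j hj hij).mono (hVthick i hi) (hVthick j hj)
    _ ≤ _ := by
        gcongr
        refine iUnion₂_subset fun i hi => iUnion₂_subset fun x hx => ?_
        refine (ball_subset_ball ?_).trans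
          (subset_biUnion_of_mem (u := fun x => ball x (u x * r)) hx.1)
        gcongr
        exact hρ i hi x hx.2

/-- The lower `u`-Minkowski content of codimension `k`. -/
def lowerContent (k : ℕ) (u : EuclideanSpace ℝ (Fin n) → ℝ) (E : Set (EuclideanSpace ℝ (Fin n))) :
    ENNReal :=
  Filter.liminf
    (fun r : ℝ =>
      normHausdorff n n (⋃ x ∈ E, Metric.ball x (u x * r)) /
        ENNReal.ofReal (unitBallVol k * r ^ k))
    (nhdsWithin 0 (Set.Ioi 0))

theorem sum_mul_le_lowerContent_of_isCompact (hL : L ≠ 0) (hk : k ≠ 0) (hu : ∀ x, u x ≤ B)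
    (hQ : ∀ i ∈ I, IsCompact (Q i)) (hdisj : (I : Set ι).PairwiseDisjoint Q)
    (hflat : ∀ i ∈ I, AlmostFlat m k L (Q i)) (hρ : ∀ i ∈ I, ∀ x ∈ Q i, (ρ i : ℝ) ≤ u x) :
    ∑ i ∈ I, (ρ i : ENNReal) ^ k * normHausdorff n m (E ∩ Q i)
      ≤ (L : ENNReal) ^ m * lowerContent k u E := by
  have hL0 : (L : ENNReal) ^ m ≠ 0 := pow_ne_zero _ (ENNReal.coe_ne_zero.2 hL)
  have hLt : (L : ENNReal) ^ m ≠ ⊤ := ENNReal.pow_ne_top ENNReal.coe_ne_top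
  rw [← ENNReal.div_le_iff' hL0 hLt]
  refine le_liminf_of_le (by isBoundedDefault) ?_
  filter_upwards [eventually_sum_mul_le_volume (E := E) hk hu hQ hdisj hflat hρ,
    self_mem_nhdsWithin] with r hr hr0
  have hr0 : 0 < r := hr0
  have hpos : 0 < unitBallVol k * r ^ k := mul_pos (unitBallVol_pos k) (pow_pos hr0 k)
  rw [ENNReal.div_le_iff' hL0 hLt, ← mul_div_assoc,
    ENNReal.le_div_iff_mul_le (Or.inl (ENNReal.ofReal_pos.2 hpos).ne')
      (Or.inl ENNReal.ofReal_ne_top)]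
  refine hr.trans ?_
  gcongr
  exact volume_le_normHausdorff n

theorem sum_mul_le_lowerContent (hL : L ≠ 0) (hk : k ≠ 0) (hu : ∀ x, u x ≤ B)
    (hQ : ∀ i ∈ I, MeasurableSet (Q i)) (hdisj : (I : Set ι).PairwiseDisjoint Q)
    (hbdd : ∀ i ∈ I, Bornology.IsBounded (Q i))
    (hflat : ∀ i ∈ I, AlmostFlat m k L (Q i)) (hρ : ∀ i ∈ I, ∀ x ∈ Q i, (ρ i : ℝ) ≤ u x) :
    ∑ i ∈ I, (ρ i : ENNReal) ^ k * (normHausdorff n m).restrict E (Q i)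
      ≤ (L : ENNReal) ^ m * lowerContent k u E := by
  set ν := (normHausdorff n m).restrict E with hν
  refine ENNReal.le_of_forall_pos_le_add fun ε hε _ => ?_
  set S : NNReal := ∑ i ∈ I, ρ i ^ k with hS
  have hε' : 0 < ε / (S + 1) := by positivity
  have hex : ∀ i ∈ I, ∃ K ⊆ Q i, IsCompact K ∧ ν (Q i) ≤ ν K + (ε / (S + 1) : NNReal) := by
    intro i hi
    have hfin : ν (Q i) < ⊤ :=
      (Measure.restrict_le_self _).trans_lt ((hflat i hi).normHausdorff_lt_top (hbdd i hi))
    have : IsFiniteMeasure (ν.restrict (Q i)) := ⟨by rwa [Measure.restrict_apply_univ]⟩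
    obtain ⟨K, hKQ, hK, hlt⟩ := (hQ i hi).exists_isCompact_lt_add
      (μ := ν.restrict (Q i)) (measure_ne_top _ _) (ENNReal.coe_ne_zero.2 hε'.ne')
    refine ⟨K, hKQ, hK, ?_⟩
    rw [Measure.restrict_apply_self, Measure.restrict_eq_self _ hKQ] at hlt
    exact hlt.le
  choose! K hKQ hK hle using hex
  calc ∑ i ∈ I, (ρ i : ENNReal) ^ k * ν (Q i)
      ≤ ∑ i ∈ I, ((ρ i : ENNReal) ^ k * normHausdorff n m (E ∩ K i) +
          (ρ i : ENNReal) ^ k * (ε / (S + 1) : NNReal)) := by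
        refine Finset.sum_le_sum fun i hi => ?_
        rw [← mul_add]
        gcongr
        refine (hle i hi).trans_eq ?_
        rw [hν, Measure.restrict_apply (hK i hi).measurableSet, inter_comm]
    _ = ∑ i ∈ I, (ρ i : ENNReal) ^ k * normHausdorff n m (E ∩ K i) +
          ((S * (ε / (S + 1)) : NNReal) : ENNReal) := by
        rw [Finset.sum_add_distrib, ← Finset.sum_mul]
        push_cast [hS]
        rfl
    _ ≤ _ := by
        gcongr
        · exact sum_mul_le_lowerContent_of_isCompact hL hk hu hK
            (fun i hi j hj hij => (hdisj hi hj hij).mono (hKQ i hi) (hKQ j hj))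
            (fun i hi => (hflat i hi).mono (hKQ i hi)) fun i hi x hx => hρ i hi x (hKQ i hi hx)
        · rw [mul_div_assoc', div_le_iff₀ (by positivity), mul_comm]
          gcongr
          exact le_self_add

theorem lintegral_le_pow_mul_lowerContent (hmk : m + k = n) (hk : k ≠ 0)
    (hE : HmRectifiable m n E) (hu0 : ∀ x, 0 ≤ u x) (hu : ∀ x, u x ≤ B) (hL : 1 < L) :
    ∫⁻ x in E, ENNReal.ofReal (u x) ^ k ∂(normHausdorff n m)
      ≤ (L : ENNReal) ^ m * lowerContent k u E := by
  obtain ⟨C, hC, hnull⟩ := hE.exists_almostFlat hmk hL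
  have hCm : ∀ i, MeasurableSet (C i) := fun i => (hC i).1.measurableSet
  have hDm : ∀ i, MeasurableSet (disjointed C i) := fun i => MeasurableSet.disjointed hCm i
  set ν := (normHausdorff n m).restrict E with hν
  have hae : ν (⋃ i, disjointed C i)ᶜ = 0 := by
    rw [iUnion_disjointed, hν, Measure.restrict_apply (MeasurableSet.iUnion hCm).compl]
    refine measure_mono_null ?_ hnull
    rintro x ⟨hx, hxE⟩
    exact ⟨hxE, hx⟩
  have hres : ν.restrict (⋃ i, disjointed C i) = ν :=
    Measure.restrict_eq_self_of_ae_mem (mem_ae_iff.2 hae)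
  rw [← hres, lintegral_iUnion hDm (disjoint_disjointed C), ENNReal.tsum_eq_iSup_sum]
  refine iSup_le fun s => ?_
  rw [← lintegral_biUnion_finset ((disjoint_disjointed C).set_pairwise _) fun i _ => hDm i,
    lintegral_eq_nnreal]
  refine iSup₂_le fun φ hφ => ?_
  rw [SimpleFunc.map_lintegral]
  have hsplit : ∀ c : NNReal, ν.restrict (⋃ i ∈ s, disjointed C i) (φ ⁻¹' {c}) =
      ∑ i ∈ s, ν (φ ⁻¹' {c} ∩ disjointed C i) := by
    intro c
    rw [Measure.restrict_apply (φ.measurableSet_fiber c), inter_iUnion₂,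
      measure_biUnion_finset _ fun i _ => (φ.measurableSet_fiber c).inter (hDm i)]
    intro i _ j _ hij
    exact (disjoint_disjointed C hij).mono inter_subset_right inter_subset_right
  have hroot : ∀ c : NNReal, (c ^ (1 / k : ℝ)) ^ k = c := by
    intro c
    rw [← NNReal.rpow_natCast, ← NNReal.rpow_mul, one_div_mul_cancel (by exact_mod_cast hk),
      NNReal.rpow_one]
  have hmain := sum_mul_le_lowerContent (m := m) (n := n) (k := k) (L := L) (E := E) (u := u)
    (I := φ.range ×ˢ s) (Q := fun p => φ ⁻¹' {p.1} ∩ disjointed C p.2)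
    (ρ := fun p => p.1 ^ (1 / k : ℝ)) (zero_lt_one.trans hL).ne' hk hu
    (fun p _ => (φ.measurableSet_fiber p.1).inter (hDm p.2)) ?_
    (fun p _ => (hC p.2).2.1.subset (inter_subset_right.trans (disjointed_subset C p.2)))
    (fun p _ => (hC p.2).2.2.mono (inter_subset_right.trans (disjointed_subset C p.2))) ?_
  · refine le_trans (le_of_eq ?_) hmain
    rw [Finset.sum_product]
    refine Finset.sum_congr rfl fun c _ => ?_
    rw [hsplit, Finset.mul_sum]
    refine Finset.sum_congr rfl fun i _ => ?_
    rw [← ENNReal.coe_pow, hroot]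
  · rintro ⟨c, i⟩ _ ⟨d, j⟩ _ hne
    rcases eq_or_ne i j with rfl | hij
    · have hcd : c ≠ d := fun h => hne (by rw [h])
      refine Disjoint.mono inter_subset_left inter_subset_left ?_
      exact (disjoint_singleton.2 hcd).preimage φ
    · exact (disjoint_disjointed C hij).mono inter_subset_right inter_subset_right
  · rintro ⟨c, i⟩ _ x ⟨hx, -⟩
    have hx : φ x = c := hx
    have h := hφ x
    rw [hx, ← ENNReal.ofReal_pow (hu0 x), ← ENNReal.ofReal_coe_nnreal,
      ENNReal.ofReal_le_ofReal_iff (pow_nonneg (hu0 x) k)] at h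
    rw [← pow_le_pow_iff_left₀ (NNReal.coe_nonneg _) (hu0 x) hk, ← NNReal.coe_pow, hroot]
    exact h

end Content

/-- For `0 ≤ m < n`, an `H^m`-rectifiable set `E ⊆ ℝⁿ` and a bounded Borel
measurable `u : ℝⁿ → [0,∞)`, the `m`-dimensional lower `u`-Minkowski content
`liminf_{r→0⁺} H^n(⋃_{x∈E} B(x, u(x)·r)) / (ω(n−m)·r^{n−m})` dominates
`∫_E u(x)^{n−m} dH^m(x)`. -/
theorem lower_u_minkowski_content_ge {m n : ℕ} (hmn : m < n)
    (E : Set (EuclideanSpace ℝ (Fin n))) (hE : HmRectifiable m n E)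
    (u : EuclideanSpace ℝ (Fin n) → ℝ) (hu0 : ∀ x, 0 ≤ u x)
    (hubd : ∃ C : ℝ, ∀ x, u x ≤ C) (humeas : Measurable u) :
    ∫⁻ x in E, ENNReal.ofReal (u x) ^ (n - m) ∂(normHausdorff n m) ≤
      Filter.liminf
        (fun r : ℝ =>
          normHausdorff n n (⋃ x ∈ E, Metric.ball x (u x * r)) /
            ENNReal.ofReal (unitBallVol (n - m) * r ^ (n - m)))
        (nhdsWithin 0 (Set.Ioi 0)) := by
  obtain ⟨B, hB⟩ := hubd
  have key : ∀ L : NNReal, 1 < L → ∫⁻ x in E, ENNReal.ofReal (u x) ^ (n - m) ∂(normHausdorff n m)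
      ≤ (L : ENNReal) ^ m * lowerContent (n - m) u E := fun L hL =>
    lintegral_le_pow_mul_lowerContent (Nat.add_sub_cancel' hmn.le) (Nat.sub_ne_zero_of_lt hmn)
      hE hu0 hB hL
  have hpow : Tendsto (fun L : NNReal => (L : ENNReal) ^ m) (nhdsWithin 1 (Ioi 1)) (nhds 1) := by
    have h : Continuous fun L : NNReal => ((L ^ m : NNReal) : ENNReal) :=
      ENNReal.continuous_coe.comp (continuous_pow m)
    simpa using (h.tendsto 1).mono_left nhdsWithin_le_nhds
  have hlim := ENNReal.Tendsto.mul_const (b := lowerContent (n - m) u E) hpow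
    (Or.inl one_ne_zero)
  rw [one_mul] at hlim
  exact ge_of_tendsto hlim (eventually_mem_nhdsWithin.mono key)
end
end

section
/- Let X be a metric space, let p, q, x ∈ X, let r = d(p, q), let 0 < ε ≤ 1/900 and b > 0 with d(p, x) ≤ 2b, and suppose d(q, x) ≤ r − d(p, x)·cos(60ε). Define φ(s) = (s − r) − (ε/b)·(s − r)². Then φ(d(q, x)) ≤ −(1 − 4ε)·d(p, x). -/
/-- Let `X` be a metric space, `p, q, x ∈ X`, `r = d(p,q)`,
`0 < ε ≤ 1/900`, `b > 0` with `d(p,x) ≤ 2b`, and suppose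
`d(q,x) ≤ r − d(p,x)·cos(60ε)`. With `φ(s) = (s − r) − (ε/b)·(s − r)²`, one has
`φ(d(q,x)) ≤ −(1 − 4ε)·d(p,x)`. -/
theorem quadratic_reparam_upper_estimate {X : Type*} [MetricSpace X] (p q x : X)
    (ε b : ℝ) (hε : 0 < ε) (hε' : ε ≤ 1 / 900) (hb : 0 < b) (hx : dist p x ≤ 2 * b)
    (hqx : dist q x ≤ dist p q - dist p x * Real.cos (60 * ε)) :
    (dist q x - dist p q) - ε / b * (dist q x - dist p q) ^ 2 ≤
      -((1 - 4 * ε) * dist p x) := by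
  have hcos : 1 - 4 * ε ≤ Real.cos (60 * ε) := by
    nlinarith [Real.one_sub_sq_div_two_le_cos (x := 60 * ε)]
  have hquad : 0 ≤ ε / b * (dist q x - dist p q) ^ 2 := by positivity
  have hmul := mul_le_mul_of_nonneg_left hcos (dist_nonneg (x := p) (y := x))
  linarith
end
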